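/- Let K be an algebraically closed field of characteristic zero and n ≥ 3. Let F be any one of the quartics F_4 = x_0x_1(x_2^2+⋯+x_n^2), F_5 = x_0x_1(x_1x_2+x_3^2+⋯+x_n^2), F_6 = x_0x_1(x_1^2+⋯+x_n^2), F_7 = x_0(x_0+x_1)(x_1^2+⋯+x_n^2), F_{8,λ} = x_0(λx_0+x_1)(x_0^2+⋯+x_n^2) with λ ∈ K, F_9 = x_0x_1(x_0^2+x_1x_2+x_3^2+⋯+x_n^2), or F_{10,λ} = x_0(−λ^2x_0+x_1+λx_2)(x_0x_1+x_2^2+⋯+x_n^2) with λ ∈ K, in K[x_0,...,x_n]. Then rk(F) ≥ 4(n−1) and prk(F) ≥ 3(n−1). -/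

import Mathlib

open MvPolynomial

/-- Apply the iterated partial-derivative operator `∏ i, (∂/∂xᵢ)^(d i)` to `F`. -/
noncomputable def diffOp {K : Type*} [CommSemiring K] {m : ℕ} (d : Fin m →₀ ℕ)
    (F : MvPolynomial (Fin m) K) : MvPolynomial (Fin m) K :=
  (List.finRange m).foldr (fun i G => (⇑(MvPolynomial.pderiv i))^[d i] G) F

/-- Apolarity action: apply the differential polynomial `δ` (in the dual variables)
to the polynomial `F`. -/
noncomputable def applyDiff {K : Type*} [CommSemiring K] {m : ℕ}
    (δ F : MvPolynomial (Fin m) K) : MvPolynomial (Fin m) K :=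
  δ.support.sum fun d => δ.coeff d • diffOp d F

/-- `IsWaringDecomp F d r`: the degree-`d` form `F` lies in the linear span of the
`d`-th powers of `r` linear forms. -/
def IsWaringDecomp {K : Type*} [Field K] {m : ℕ} (F : MvPolynomial (Fin m) K)
    (d r : ℕ) : Prop :=
  ∃ ℓ : Fin r → MvPolynomial (Fin m) K,
    (∀ j, (ℓ j).IsHomogeneous 1) ∧
    F ∈ Submodule.span K (Set.range fun j => ℓ j ^ d)

/-- The symmetric (Waring) rank of a degree-`d` form. -/
noncomputable def waringRank {K : Type*} [Field K] {m : ℕ}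
    (F : MvPolynomial (Fin m) K) (d : ℕ) : ℕ :=
  sInf {r | IsWaringDecomp F d r}

/-- `IsPartialDecomp F d r`: all first partial derivatives of the degree-`d` form `F`
lie simultaneously in the span of the `(d-1)`-st powers of `r` linear forms. -/
def IsPartialDecomp {K : Type*} [Field K] {m : ℕ} (F : MvPolynomial (Fin m) K)
    (d r : ℕ) : Prop :=
  ∃ t : Fin r → MvPolynomial (Fin m) K,
    (∀ j, (t j).IsHomogeneous 1) ∧
    ∀ i : Fin m, (MvPolynomial.pderiv i F) ∈
      Submodule.span K (Set.range fun j => t j ^ (d - 1))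

/-- The partially symmetric rank of a degree-`d` form. -/
noncomputable def pWaringRank {K : Type*} [Field K] {m : ℕ}
    (F : MvPolynomial (Fin m) K) (d : ℕ) : ℕ :=
  sInf {r | IsPartialDecomp F d r}

/-- `∑_{i ≥ t} x_i²`. -/
noncomputable def sumSqFrom (K : Type*) [CommSemiring K] (m t : ℕ) :
    MvPolynomial (Fin m) K :=
  ∑ i ∈ Finset.univ.filter (fun i : Fin m => t ≤ (i : ℕ)), X i ^ 2

theorem Submodule.exists_finset_card_eq_finrank_forall_exists_eqOn {K ι : Type*} [Field K]
    [Fintype ι] (A : Submodule K (ι → K)) :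
    ∃ S : Finset ι, S.card = Module.finrank K A ∧
      ∀ g : ι → K, ∃ a ∈ A, ∀ s ∈ S, a s = g s := by
  classical
  let good : Finset ι → Prop := fun S => ∀ g : ι → K, ∃ a ∈ A, ∀ s ∈ S, a s = g s
  have h0 : good ∅ := fun g => ⟨0, A.zero_mem, by simp⟩
  obtain ⟨S, hS⟩ := (Set.toFinite {S | good S}).exists_maximal ⟨∅, h0⟩
  refine ⟨S, ?_, hS.prop⟩
  let ρ : A →ₗ[K] (S → K) := (LinearMap.funLeft K K (Subtype.val : S → ι)).comp A.subtype
  have hsurj : Function.Surjective ρ := by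
    intro g
    obtain ⟨a, ha, h⟩ := hS.prop fun i => if hi : i ∈ S then g ⟨i, hi⟩ else 0
    exact ⟨⟨a, ha⟩, funext fun s => by simp [ρ, LinearMap.funLeft_apply, h s s.2]⟩
  have hinj : Function.Injective ρ := by
    rw [injective_iff_map_eq_zero]
    rintro ⟨a, ha⟩ h
    have haS : ∀ s ∈ S, a s = 0 := fun s hs => congrFun h ⟨s, hs⟩
    by_contra hne
    obtain ⟨j, hj⟩ : ∃ j, a j ≠ 0 := by
      by_contra! hz
      exact hne (Subtype.ext (funext hz))
    have hgood : good (insert j S) := by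
      intro g
      obtain ⟨b, hb, hbS⟩ := hS.prop g
      refine ⟨b + ((g j - b j) / a j) • a, A.add_mem hb (A.smul_mem _ ha), ?_⟩
      intro s hs
      rcases Finset.mem_insert.1 hs with rfl | hs
      · simp [hj]
      · simp [haS s hs, hbS s hs]
    have := hS.le_of_ge hgood (Finset.subset_insert j S) (Finset.mem_insert_self j S)
    exact hj (haS j this)
  simpa using (LinearEquiv.ofBijective ρ ⟨hinj, hsurj⟩).finrank_eq.symm

/-- The span of the pointwise products of two elements of a space of functions has at least the
dimension of that space. -/
theorem Submodule.finrank_le_finrank_span_mul {K ι : Type*} [Field K] [Fintype ι]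
    (A : Submodule K (ι → K)) :
    Module.finrank K A ≤
      Module.finrank K (Submodule.span K {x : ι → K | ∃ a ∈ A, ∃ b ∈ A, x = a * b}) := by
  classical
  obtain ⟨S, hS, h⟩ := A.exists_finset_card_eq_finrank_forall_exists_eqOn
  set A₂ := Submodule.span K {x : ι → K | ∃ a ∈ A, ∃ b ∈ A, x = a * b}
  have htop : A₂.map (LinearMap.funLeft K K (Subtype.val : S → ι)) = ⊤ := by
    rw [eq_top_iff, ← (Pi.basisFun K S).span_eq, Submodule.span_le]
    rintro _ ⟨s, rfl⟩
    obtain ⟨a, ha, has⟩ := h (Pi.single (s : ι) 1)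
    refine ⟨a * a, Submodule.subset_span ⟨a, ha, a, ha, rfl⟩, funext fun t => ?_⟩
    by_cases hts : t = s
    · subst hts
      simp [LinearMap.funLeft_apply, has t t.2]
    · have : (t : ι) ≠ s := fun h => hts (Subtype.ext h)
      simp [LinearMap.funLeft_apply, has t t.2, hts, this]
  have := Submodule.finrank_map_le (LinearMap.funLeft K K (Subtype.val : S → ι)) A₂
  rw [htop, finrank_top, Module.finrank_fintype_fun_eq_card, Fintype.card_coe] at this
  omega

/-- The full polarization of the quartic form `α β Q`, where `α`, `β` are linear and the quadratic
form `Q` has polar form `B`. -/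
def polarQuartic {K V : Type*} [Field K] (α β : V → K) (B : V → V → K) (a b c d : V) : K :=
  (α a * β b + β a * α b) * B c d + (α c * β d + β c * α d) * B a b +
  (α a * β c + β a * α c) * B b d + (α a * β d + β a * α d) * B b c +
  (α b * β c + β b * α c) * B a d + (α b * β d + β b * α d) * B a c

theorem four_mul_le_of_polarQuartic_eq_sum {K V : Type*} [Field K] [CharZero K] [AddCommGroup V]
    [Module K V] [FiniteDimensional K V] {r m : ℕ} (α β : V →ₗ[K] K) (B : V → V → K)
    (hB : ∀ u v, B u v = B v u) (e f : V) (hαe : α e = 1) (hβe : β e = 0) (hαf : α f = 0)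
    (hβf : β f = 1) (W Z : Submodule K V) (hWα : ∀ w ∈ W, α w = 0) (hWβ : ∀ w ∈ W, β w = 0)
    (hZα : ∀ z ∈ Z, α z = 0) (hW : m ≤ Module.finrank K W) (hZ : m ≤ Module.finrank K Z)
    (hBW : ∀ w ∈ W, (∀ a ∈ W, B a w = 0) → B f w = 0 → w = 0)
    (hBZ : ∀ z ∈ Z, (∀ a ∈ W, B a z + β z * B a f = 0) → z = 0)
    (hBWZ : ∀ v ∈ W, ∀ w ∈ W, (∀ z ∈ Z, B w z + β z * (B w f + B w v) = 0) → w = 0)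
    (g : V → Fin r → K) (p : Fin r → V →ₗ[K] K)
    (hG : ∀ a b c d, polarQuartic α β B a b c d = ∑ j, g a j * p j b * p j c * p j d) :
    4 * m ≤ r := by
  classical
  let P : V →ₗ[K] (Fin r → K) := LinearMap.pi p
  have hP : ∀ v j, P v j = p j v := fun v j => rfl
  let ψ : V → V → (Fin r → K) →ₗ[K] K := fun a b =>
    ∑ j, (g a j * p j b) • LinearMap.proj j
  have hψ : ∀ a b x, ψ a b x = ∑ j, g a j * p j b * x j := fun a b x => by
    simp [ψ, LinearMap.sum_apply]
  have hψP : ∀ a b c d, ψ a b (P c * P d) = polarQuartic α β B a b c d := fun a b c d => by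
    rw [hψ, hG]
    exact Finset.sum_congr rfl fun j _ => by simp only [Pi.mul_apply, hP]; ring
  set A₀ := Submodule.span K {x | ∃ a ∈ W.map P, ∃ b ∈ W.map P, x = a * b} with hA₀
  have hψA₀ : ∀ x ∈ A₀, ∀ a b, (α a = 0 ∧ β a = 0 ∨ α a = 0 ∧ α b = 0) → ψ a b x = 0 := by
    intro x hx a b hab
    induction hx using Submodule.span_induction with
    | mem x hx =>
      obtain ⟨_, ⟨u, hu, rfl⟩, _, ⟨v, hv, rfl⟩, rfl⟩ := hx
      rw [hψP]
      rcases hab with ⟨h1, h2⟩ | ⟨h1, h2⟩ <;>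
        simp [polarQuartic, hWα u hu, hWβ u hu, hWα v hv, hWβ v hv, h1, h2]
    | zero => simp
    | add x y _ _ hx hy => simp [hx, hy]
    | smul c x _ hx => simp [hx]
  let Φ : (W × Z) × A₀ →ₗ[K] (Fin r → K) :=
    ((((LinearMap.mulLeft K (P e)).comp (P.comp W.subtype))).coprod
      ((LinearMap.mulLeft K (P f)).comp (P.comp Z.subtype))).coprod A₀.subtype
  have hΦ : ∀ (w : W) (z : Z) (x : A₀), Φ ((w, z), x) = P e * P w + P f * P z + x :=
    fun w z x => rfl
  have hΦinj : Function.Injective Φ := by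
    rw [injective_iff_map_eq_zero]
    rintro ⟨⟨⟨w, hw⟩, ⟨z, hz⟩⟩, ⟨x, hx⟩⟩ h
    rw [hΦ] at h
    have key : ∀ a b, (α a = 0 ∧ β a = 0 ∨ α a = 0 ∧ α b = 0) →
        polarQuartic α β B a b e w + polarQuartic α β B a b f z = 0 := by
      intro a b hab
      have := congrArg (ψ a b) h
      simpa [hψP, hψA₀ x hx a b hab] using this
    have hw0 : w = 0 := by
      refine hBW w hw (fun a ha => ?_) ?_
      · have := key a f (.inl ⟨hWα a ha, hWβ a ha⟩)
        simpa [polarQuartic, hαe, hβe, hαf, hβf, hWα a ha, hWβ a ha, hWα w hw, hWβ w hw,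
          hZα z hz] using this
      · have := key f f (.inr ⟨hαf, hαf⟩)
        simp [polarQuartic, hαe, hβe, hαf, hβf, hWα w hw, hWβ w hw, hZα z hz] at this
        exact this
    have hz0 : z = 0 := by
      refine hBZ z hz fun a ha => ?_
      have := key a e (.inl ⟨hWα a ha, hWβ a ha⟩)
      simp [polarQuartic, hαe, hβe, hαf, hβf, hWα a ha, hWβ a ha, hWα w hw, hWβ w hw,
          hZα z hz] at this
      linear_combination this
    subst hw0 hz0
    have hx0 : x = 0 := by simpa using h
    subst hx0
    rfl
  have hPW : m ≤ Module.finrank K (W.map P) := by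
    have : Function.Injective (P.comp W.subtype) := by
      rw [injective_iff_map_eq_zero]
      intro w hw
      have : Φ ((w, 0), 0) = Φ 0 := by
        rw [map_zero, hΦ]
        have : P w = 0 := hw
        simp [this]
      simpa using hΦinj this
    have h2 := LinearMap.finrank_range_of_inj this
    rw [LinearMap.range_comp, Submodule.range_subtype] at h2
    omega
  have hA₀m : m ≤ Module.finrank K A₀ := hPW.trans (Submodule.finrank_le_finrank_span_mul _)
  have hΦdim : 3 * m ≤ Module.finrank K (LinearMap.range Φ) := by
    rw [LinearMap.finrank_range_of_inj hΦinj, Module.finrank_prod, Module.finrank_prod]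
    omega
  obtain ⟨S, hScard, hS⟩ :=
    (LinearMap.range Φ).exists_finset_card_eq_finrank_forall_exists_eqOn
  obtain ⟨_, ⟨⟨⟨⟨v, hv⟩, ⟨z', hz'⟩⟩, ⟨x, hx⟩⟩, rfl⟩, hy⟩ := hS (-(P e * P f))
  rw [hΦ] at hy
  set y := P e * P f + (P e * P v + P f * P z' + x) with hydef
  have hyS : ∀ s ∈ S, y s = 0 := fun s hs => by
    rw [hydef, Pi.add_apply]
    have := hy s hs
    simp only [Pi.neg_apply] at this ⊢
    rw [this]; ring
  have hinj : Function.Injective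
      ((LinearMap.pi fun j : (Sᶜ : Finset (Fin r)) => p j).comp W.subtype) := by
    rw [injective_iff_map_eq_zero]
    rintro ⟨w, hw⟩ h
    have hpw : ∀ j ∉ S, p j w = 0 := fun j hj => congrFun h ⟨j, Finset.mem_compl.2 hj⟩
    refine Subtype.ext (hBWZ v hv w hw fun z hz => ?_)
    have h0 : ψ z w y = 0 := by
      rw [hψ]
      refine Finset.sum_eq_zero fun j _ => ?_
      by_cases hj : j ∈ S
      · simp [hyS j hj]
      · simp [hpw j hj]
    rw [hydef, map_add, map_add, map_add,
      hψA₀ x hx z w (.inr ⟨hZα z hz, hWα w hw⟩), hψP, hψP, hψP] at h0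
    simp [polarQuartic, hαe, hβe, hαf, hβf, hWα v hv, hWβ v hv, hWα w hw, hWβ w hw,
          hZα z hz, hZα z' hz'] at h0
    rw [hB w z]
    linear_combination h0
  have := LinearMap.finrank_le_finrank_of_injective hinj
  rw [Module.finrank_fintype_fun_eq_card, Fintype.card_coe, Finset.card_compl,
    Fintype.card_fin] at this
  have := S.card_le_univ
  rw [Fintype.card_fin] at this
  omega

/-- The directional derivative along `v`. -/
noncomputable def dirDeriv {K : Type*} [Field K] {N : ℕ} (v : Fin N → K) :
    Derivation K (MvPolynomial (Fin N) K) (MvPolynomial (Fin N) K) :=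
  mkDerivation K fun i => C (v i)

@[simp]
theorem dirDeriv_X {K : Type*} [Field K] {N : ℕ} (v : Fin N → K) (i : Fin N) :
    dirDeriv v (X i) = C (v i) :=
  mkDerivation_X K _ i

@[simp]
theorem dirDeriv_C {K : Type*} [Field K] {N : ℕ} (v : Fin N → K) (c : K) :
    dirDeriv v (C c) = 0 :=
  derivation_C _ c

theorem dirDeriv_apply {K : Type*} [Field K] {N : ℕ} (v : Fin N → K)
    (F : MvPolynomial (Fin N) K) : dirDeriv v F = ∑ i, v i • pderiv i F := by
  have hsum : ∀ G : MvPolynomial (Fin N) K,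
      (∑ i, v i • (pderiv i : Derivation K (MvPolynomial (Fin N) K) _)) G =
        ∑ i, v i • pderiv i G := fun G => by
    rw [← Derivation.coeFnAddMonoidHom_apply, map_sum, Finset.sum_apply]
    rfl
  rw [← hsum]
  refine DFunLike.congr_fun (derivation_ext fun j => ?_) F
  rw [hsum]
  simp [pderiv_X, Pi.single_apply, smul_eq_C_mul]

theorem exists_dirDeriv_eq_C {K : Type*} [Field K] {N : ℕ} {t : MvPolynomial (Fin N) K}
    (ht : t.IsHomogeneous 1) :
    ∃ p : (Fin N → K) →ₗ[K] K, ∀ v, dirDeriv v t = C (p v) := by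
  have hc : ∀ i, ∃ c : K, pderiv i t = C c := fun i =>
    ⟨_, totalDegree_eq_zero_iff_eq_C.1 (Nat.le_zero.1 (ht.pderiv (i := i)).totalDegree_le)⟩
  choose c hc using hc
  refine ⟨∑ i, c i • LinearMap.proj i, fun v => ?_⟩
  simp [dirDeriv_apply, hc, smul_eq_C_mul, mul_comm]

theorem IsPartialDecomp.exists_dirDeriv_eq_C_sum {K : Type*} [Field K] [CharZero K] {N r : ℕ}
    {F : MvPolynomial (Fin N) K} (h : IsPartialDecomp F 4 r) :
    ∃ (g : (Fin N → K) → Fin r → K) (p : Fin r → (Fin N → K) →ₗ[K] K), ∀ a b c d,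
      dirDeriv d (dirDeriv c (dirDeriv b (dirDeriv a F))) =
        C (∑ j, g a j * p j b * p j c * p j d) := by
  obtain ⟨t, ht, hF⟩ := h
  choose p hp using fun j => exists_dirDeriv_eq_C (ht j)
  have hmem : ∀ a, ∃ q : Fin r → K, ∑ j, q j • t j ^ 3 = dirDeriv a F := fun a => by
    rw [← Submodule.mem_span_range_iff_exists_fun, dirDeriv_apply]
    exact Submodule.sum_mem _ fun i _ => Submodule.smul_mem _ _ (hF i)
  choose q hq using hmem
  refine ⟨fun a j => 6 * q a j, p, fun a b c d => ?_⟩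
  simp only [← hq, map_sum, smul_eq_C_mul]
  refine Finset.sum_congr rfl fun j _ => ?_
  simp only [Derivation.leibniz, Derivation.leibniz_pow, hp, dirDeriv_C, smul_eq_mul, nsmul_eq_mul,
    map_mul, map_add, Derivation.map_natCast, map_ofNat, Nat.cast_ofNat]
  simp only [Nat.reduceSub, pow_one, map_zero, mul_zero, add_zero, zero_add]
  have h3 : dirDeriv c (3 : MvPolynomial (Fin N) K) = 0 := by
    simpa using (dirDeriv c).map_natCast 3
  have h3' : dirDeriv d (3 : MvPolynomial (Fin N) K) = 0 := by
    simpa using (dirDeriv d).map_natCast 3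
  simp only [h3, h3', map_zero, mul_zero, add_zero]
  ring

theorem dirDeriv_mul_mul_eq_polarQuartic {K : Type*} [Field K] {N : ℕ}
    {A L Q : MvPolynomial (Fin N) K} {α β : (Fin N → K) → K} {B : (Fin N → K) → (Fin N → K) → K}
    (hA : ∀ v, dirDeriv v A = C (α v)) (hL : ∀ v, dirDeriv v L = C (β v))
    (hQ : ∀ u v, dirDeriv v (dirDeriv u Q) = C (B u v)) (a b c d : Fin N → K) :
    dirDeriv d (dirDeriv c (dirDeriv b (dirDeriv a (A * L * Q)))) =
      C (polarQuartic α β B a b c d) := by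
  simp only [Derivation.leibniz, hA, hL, hQ, dirDeriv_C, smul_eq_mul, map_add, mul_zero, add_zero,
    zero_add, polarQuartic, map_mul]
  ring

theorem mul_mem_span_pow_four {K : Type*} [Field K] [CharZero K] {N : ℕ}
    {a b c d : MvPolynomial (Fin N) K} (ha : a.IsHomogeneous 1) (hb : b.IsHomogeneous 1)
    (hc : c.IsHomogeneous 1) (hd : d.IsHomogeneous 1) :
    a * b * (c * d) ∈
      Submodule.span K {x : MvPolynomial (Fin N) K | ∃ ℓ, ℓ.IsHomogeneous 1 ∧ x = ℓ ^ 4} := by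
  set P := Submodule.span K {x : MvPolynomial (Fin N) K | ∃ ℓ, ℓ.IsHomogeneous 1 ∧ x = ℓ ^ 4}
  have hP : ∀ ℓ : MvPolynomial (Fin N) K, ℓ.IsHomogeneous 1 → ℓ ^ 4 ∈ P :=
    fun ℓ hℓ => Submodule.subset_span ⟨ℓ, hℓ, rfl⟩
  have h192 : (192 : K) ≠ 0 := by norm_num
  rw [← P.smul_mem_iff h192]
  have key : (192 : K) • (a * b * (c * d)) =
      (a + b + c + d) ^ 4 - (a + b + c - d) ^ 4 - (a + b - c + d) ^ 4 + (a + b - c - d) ^ 4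
      - (a - b + c + d) ^ 4 + (a - b + c - d) ^ 4 + (a - b - c + d) ^ 4 - (a - b - c - d) ^ 4 := by
    rw [smul_eq_C_mul, map_ofNat]
    ring
  rw [key]
  refine P.sub_mem (P.add_mem (P.add_mem (P.sub_mem (P.add_mem (P.sub_mem (P.sub_mem ?_ ?_) ?_)
    ?_) ?_) ?_) ?_) ?_ <;> apply hP
  · exact ((ha.add hb).add hc).add hd
  · exact ((ha.add hb).add hc).sub hd
  · exact ((ha.add hb).sub hc).add hd
  · exact ((ha.add hb).sub hc).sub hd
  · exact ((ha.sub hb).add hc).add hd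
  · exact ((ha.sub hb).add hc).sub hd
  · exact ((ha.sub hb).sub hc).add hd
  · exact ((ha.sub hb).sub hc).sub hd

theorem exists_isWaringDecomp_mul_mul {K : Type*} [Field K] [CharZero K] {N : ℕ}
    {A L Q : MvPolynomial (Fin N) K} (hA : A.IsHomogeneous 1) (hL : L.IsHomogeneous 1)
    (hQ : Q ∈ Submodule.span K {x | ∃ c d : MvPolynomial (Fin N) K,
      c.IsHomogeneous 1 ∧ d.IsHomogeneous 1 ∧ x = c * d}) :
    ∃ r, IsWaringDecomp (A * L * Q) 4 r := by
  have hmem : A * L * Q ∈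
      Submodule.span K {x : MvPolynomial (Fin N) K | ∃ ℓ, ℓ.IsHomogeneous 1 ∧ x = ℓ ^ 4} := by
    induction hQ using Submodule.span_induction with
    | mem x hx =>
      obtain ⟨c, d, hc, hd, rfl⟩ := hx
      exact mul_mem_span_pow_four hA hL hc hd
    | zero => simp
    | add x y _ _ hx hy => rw [mul_add]; exact Submodule.add_mem _ hx hy
    | smul c x _ hx => rw [mul_smul_comm]; exact Submodule.smul_mem _ c hx
  obtain ⟨r, q, x, hx⟩ := Submodule.mem_span_set'.1 hmem
  choose ℓ hℓ hxℓ using fun i => (x i).2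
  refine ⟨r, ℓ, hℓ, ?_⟩
  rw [← hx]
  exact Submodule.sum_mem _ fun i _ => Submodule.smul_mem _ _
    (Submodule.subset_span ⟨i, (hxℓ i).symm⟩)

theorem IsWaringDecomp.isPartialDecomp {K : Type*} [Field K] {N d r : ℕ}
    {F : MvPolynomial (Fin N) K} (h : IsWaringDecomp F d r) : IsPartialDecomp F d r := by
  obtain ⟨ℓ, hℓ, hF⟩ := h
  refine ⟨ℓ, hℓ, fun i => ?_⟩
  obtain ⟨c, rfl⟩ := (Submodule.mem_span_range_iff_exists_fun K).1 hF
  rw [map_sum]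
  refine Submodule.sum_mem _ fun j _ => ?_
  have hc : pderiv i (ℓ j) = C (coeff 0 (pderiv i (ℓ j))) :=
    totalDegree_eq_zero_iff_eq_C.1 (Nat.le_zero.1 ((hℓ j).pderiv (i := i)).totalDegree_le)
  have : pderiv i (c j • ℓ j ^ d) =
      (c j * (d * coeff 0 (pderiv i (ℓ j)))) • ℓ j ^ (d - 1) := by
    rw [Derivation.map_smul, Derivation.leibniz_pow, hc, coeff_C]
    simp only [smul_eq_C_mul, nsmul_eq_mul, smul_eq_mul, map_mul, map_natCast, if_true]
    ring
  rw [this]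
  exact Submodule.smul_mem _ _ (Submodule.subset_span ⟨j, rfl⟩)

theorem le_finrank_ker_inf_ker {K : Type*} [Field K] {k : ℕ} (φ χ : (Fin (k + 4) → K) →ₗ[K] K) :
    k + 2 ≤ Module.finrank K (LinearMap.ker φ ⊓ LinearMap.ker χ : Submodule K _) := by
  have h := (φ.prod χ).finrank_range_add_finrank_ker
  have h2 := (LinearMap.range (φ.prod χ)).finrank_le
  rw [LinearMap.ker_prod, Module.finrank_fin_fun] at h
  rw [Module.finrank_prod, Module.finrank_self] at h2
  omega

/-- Twice the bilinear form `∑_{i ≥ t} uᵢ vᵢ`, the polar form of `sumSqFrom`. -/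
def sumMulFrom {K : Type*} [Field K] {N : ℕ} (t : ℕ) (u v : Fin N → K) : K :=
  ∑ i ∈ Finset.univ.filter (fun i : Fin N => t ≤ (i : ℕ)), 2 * (u i * v i)

theorem sumMulFrom_comm {K : Type*} [Field K] {N : ℕ} (t : ℕ) (u v : Fin N → K) :
    sumMulFrom t u v = sumMulFrom t v u :=
  Finset.sum_congr rfl fun i _ => by rw [mul_comm (u i)]

theorem sumMulFrom_single {K : Type*} [Field K] {N : ℕ} (t : ℕ) (i : Fin N) (v : Fin N → K) :
    sumMulFrom t (Pi.single i 1) v = if t ≤ (i : ℕ) then 2 * v i else 0 := by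
  simp [sumMulFrom, Pi.single_apply]

theorem sumMulFrom_eq_zero {K : Type*} [Field K] {N : ℕ} {t : ℕ} {u v : Fin N → K}
    (h : ∀ i : Fin N, t ≤ (i : ℕ) → u i = 0) : sumMulFrom t u v = 0 :=
  Finset.sum_eq_zero fun i hi => by simp [h i (Finset.mem_filter.1 hi).2]

theorem dirDeriv_dirDeriv_sumSqFrom {K : Type*} [Field K] {N : ℕ} (t : ℕ) (u v : Fin N → K) :
    dirDeriv v (dirDeriv u (sumSqFrom K N t)) = C (sumMulFrom t u v) := by
  simp only [sumSqFrom, sumMulFrom, map_sum]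
  refine Finset.sum_congr rfl fun i _ => ?_
  rw [pow_two]
  simp only [Derivation.leibniz, dirDeriv_X, smul_eq_mul, map_add, dirDeriv_C, map_mul, map_ofNat]
  ring

theorem sumSqFrom_mem_span_mul (K : Type*) [Field K] (N t : ℕ) :
    sumSqFrom K N t ∈ Submodule.span K {x | ∃ c d : MvPolynomial (Fin N) K,
      c.IsHomogeneous 1 ∧ d.IsHomogeneous 1 ∧ x = c * d} :=
  Submodule.sum_mem _ fun i _ =>
    Submodule.subset_span ⟨X i, X i, isHomogeneous_X K i, isHomogeneous_X K i, pow_two _⟩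

/-- A quadratic form together with its polar form. -/
structure IsQuadraticWithPolar {K : Type*} [Field K] {N : ℕ} (Q : MvPolynomial (Fin N) K)
    (B : (Fin N → K) → (Fin N → K) → K) : Prop where
  mem_span : Q ∈ Submodule.span K {x | ∃ c d : MvPolynomial (Fin N) K,
    c.IsHomogeneous 1 ∧ d.IsHomogeneous 1 ∧ x = c * d}
  dirDeriv_dirDeriv : ∀ u v, dirDeriv v (dirDeriv u Q) = C (B u v)
  symm : ∀ u v, B u v = B v u

theorem isQuadraticWithPolar_sumSqFrom (K : Type*) [Field K] (N t : ℕ) :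
    IsQuadraticWithPolar (sumSqFrom K N t) (sumMulFrom t) :=
  ⟨sumSqFrom_mem_span_mul K N t, dirDeriv_dirDeriv_sumSqFrom t, sumMulFrom_comm t⟩

theorem isQuadraticWithPolar_X_mul_X (K : Type*) [Field K] {N : ℕ} (i j : Fin N) :
    IsQuadraticWithPolar (X i * X j : MvPolynomial (Fin N) K)
      (fun u v => u i * v j + u j * v i) where
  mem_span := Submodule.subset_span ⟨X i, X j, isHomogeneous_X K i, isHomogeneous_X K j, rfl⟩
  dirDeriv_dirDeriv u v := by
    simp only [Derivation.leibniz, dirDeriv_X, smul_eq_mul, map_add, dirDeriv_C, map_mul]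
    ring
  symm u v := by ring

theorem IsQuadraticWithPolar.add {K : Type*} [Field K] {N : ℕ} {Q Q' : MvPolynomial (Fin N) K}
    {B B' : (Fin N → K) → (Fin N → K) → K} (h : IsQuadraticWithPolar Q B)
    (h' : IsQuadraticWithPolar Q' B') :
    IsQuadraticWithPolar (Q + Q') (fun u v => B u v + B' u v) where
  mem_span := Submodule.add_mem _ h.mem_span h'.mem_span
  dirDeriv_dirDeriv u v := by
    simp only [map_add, h.dirDeriv_dirDeriv, h'.dirDeriv_dirDeriv]
  symm u v := by rw [h.symm, h'.symm]

theorem le_waringRank_and_le_pWaringRank {K : Type*} [Field K] [CharZero K] {k : ℕ}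
    {L Q : MvPolynomial (Fin (k + 4)) K} {B : (Fin (k + 4) → K) → (Fin (k + 4) → K) → K}
    (β γ : (Fin (k + 4) → K) →ₗ[K] K) (hL : L.IsHomogeneous 1)
    (hLβ : ∀ v, dirDeriv v L = C (β v)) (hQ : IsQuadraticWithPolar Q B)
    (e f : Fin (k + 4) → K) (he : e 0 = 1) (hβe : β e = 0) (hf : f 0 = 0) (hβf : β f = 1)
    (hBW : ∀ w, w 0 = 0 → β w = 0 → (∀ a, a 0 = 0 → β a = 0 → B a w = 0) → B f w = 0 → w = 0)
    (hBZ : ∀ z, z 0 = 0 → γ z = 0 →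
      (∀ a, a 0 = 0 → β a = 0 → B a z + β z * B a f = 0) → z = 0)
    (hBWZ : ∀ v, v 0 = 0 → β v = 0 → ∀ w, w 0 = 0 → β w = 0 →
      (∀ z, z 0 = 0 → γ z = 0 → B w z + β z * (B w f + B w v) = 0) → w = 0) :
    4 * (k + 3 - 1) ≤ waringRank (X 0 * L * Q) 4 ∧
      3 * (k + 3 - 1) ≤ pWaringRank (X 0 * L * Q) 4 := by
  obtain ⟨r₀, hr₀⟩ := exists_isWaringDecomp_mul_mul (isHomogeneous_X K (0 : Fin (k + 4))) hL
    hQ.mem_span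
  have hmain : ∀ r, IsPartialDecomp (X 0 * L * Q) 4 r → 4 * (k + 2) ≤ r := by
    intro r hr
    obtain ⟨g, p, hgp⟩ := hr.exists_dirDeriv_eq_C_sum
    refine four_mul_le_of_polarQuartic_eq_sum
      (LinearMap.proj (R := K) (φ := fun _ => K) (0 : Fin (k + 4))) β B hQ.symm e f he hβe hf hβf
      (LinearMap.ker (LinearMap.proj 0) ⊓ LinearMap.ker β)
      (LinearMap.ker (LinearMap.proj 0) ⊓ LinearMap.ker γ)
      (fun w hw => LinearMap.mem_ker.1 hw.1) (fun w hw => hw.2)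
      (fun w hw => LinearMap.mem_ker.1 hw.1) (le_finrank_ker_inf_ker _ _)
      (le_finrank_ker_inf_ker _ _)
      (fun w hw h => hBW w hw.1 hw.2 fun a ha hβa => h a ⟨ha, hβa⟩)
      (fun z hz h => hBZ z hz.1 hz.2 fun a ha hβa => h a ⟨ha, hβa⟩)
      (fun v hv w hw h => hBWZ v hv.1 hv.2 w hw.1 hw.2 fun z hz hγz => h z ⟨hz, hγz⟩)
      g p fun a b c d => C_injective (Fin (k + 4)) K ?_
    rw [← hgp]
    exact (dirDeriv_mul_mul_eq_polarQuartic (fun v => dirDeriv_X v 0) hLβ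
      hQ.dirDeriv_dirDeriv a b c d).symm
  refine ⟨le_csInf ⟨r₀, hr₀⟩ fun r hr => ?_,
    le_csInf ⟨r₀, hr₀.isPartialDecomp⟩ fun r hr => ?_⟩
  · have := hmain r hr.isPartialDecomp
    omega
  · have := hmain r hr
    omega

theorem le_waringRank_and_le_pWaringRank_of_nondegenerate {K : Type*} [Field K] [CharZero K]
    {k : ℕ} {L Q : MvPolynomial (Fin (k + 4)) K} {B : (Fin (k + 4) → K) → (Fin (k + 4) → K) → K}
    (β : (Fin (k + 4) → K) →ₗ[K] K) (hL : L.IsHomogeneous 1)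
    (hLβ : ∀ v, dirDeriv v L = C (β v)) (hQ : IsQuadraticWithPolar Q B)
    (hβ : β (Pi.single 1 1) = 1)
    (hB : ∀ w, w 0 = 0 → β w = 0 → (∀ a, a 0 = 0 → β a = 0 → B a w = 0) → w = 0) :
    4 * (k + 3 - 1) ≤ waringRank (X 0 * L * Q) 4 ∧
      3 * (k + 3 - 1) ≤ pWaringRank (X 0 * L * Q) 4 := by
  refine le_waringRank_and_le_pWaringRank β β hL hLβ hQ
    (Pi.single 0 1 - β (Pi.single 0 1) • Pi.single 1 1) (Pi.single 1 1) (by simp)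
    (by simp [hβ]) (by simp) hβ (fun w h0 h1 h _ => hB w h0 h1 h)
    (fun z h0 h1 h => hB z h0 h1 fun a ha ha' => ?_)
    (fun v _ _ w h0 h1 h => hB w h0 h1 fun a ha ha' => ?_)
  · simpa [h1] using h a ha ha'
  · rw [hQ.symm]
    simpa [ha'] using h a ha ha'

theorem le_waringRank_and_le_pWaringRank_of_degenerate {K : Type*} [Field K] [CharZero K]
    {k : ℕ} {Q : MvPolynomial (Fin (k + 4)) K} {B : (Fin (k + 4) → K) → (Fin (k + 4) → K) → K}
    (hQ : IsQuadraticWithPolar Q B)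
    (hB : ∀ u v, u 0 = 0 → B u v = u 1 * v 2 + u 2 * v 1 + sumMulFrom 3 u v) :
    4 * (k + 3 - 1) ≤ waringRank (X 0 * X 1 * Q) 4 ∧
      3 * (k + 3 - 1) ≤ pWaringRank (X 0 * X 1 * Q) 4 := by
  have hval : ((2 : Fin (k + 4)) : ℕ) = 2 := rfl
  have hne0 : ∀ i : Fin (k + 4), 3 ≤ (i : ℕ) → (0 : Fin (k + 4)) ≠ i := by
    rintro i hi rfl; simp at hi
  have hne1 : ∀ i : Fin (k + 4), 3 ≤ (i : ℕ) → (1 : Fin (k + 4)) ≠ i := by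
    rintro i hi rfl; simp at hi
  have hne2 : ∀ i : Fin (k + 4), 3 ≤ (i : ℕ) → (2 : Fin (k + 4)) ≠ i := by
    rintro i hi rfl; omega
  have hext : ∀ w : Fin (k + 4) → K, w 0 = 0 → w 1 = 0 → w 2 = 0 →
      (∀ i : Fin (k + 4), 3 ≤ (i : ℕ) → w i = 0) → w = 0 := by
    intro w h0 h1 h2 h
    funext i
    rcases i with ⟨_ | _ | _ | i, hi⟩
    · exact h0
    · exact h1
    · exact h2
    · exact h _ (by simp)
  have h20 : (2 : Fin (k + 4)) ≠ 0 := Fin.ne_of_val_ne (by rw [hval]; simp)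
  have h21 : (2 : Fin (k + 4)) ≠ 1 := Fin.ne_of_val_ne (by rw [hval]; simp)
  have hsingle : ∀ (v : Fin (k + 4) → K) (i : Fin (k + 4)), 3 ≤ (i : ℕ) →
      B (Pi.single i 1) v = 2 * v i := by
    intro v i hi
    rw [hB _ _ (by simp [hne0 i hi]), sumMulFrom_single, if_pos hi]
    simp [hne1 i hi, hne2 i hi]
  have hval1 : ¬ 3 ≤ ((1 : Fin (k + 4)) : ℕ) := by simp
  have hval2 : ¬ 3 ≤ ((2 : Fin (k + 4)) : ℕ) := by omega
  refine le_waringRank_and_le_pWaringRank (LinearMap.proj 1) (LinearMap.proj 2)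
    (isHomogeneous_X K _) (fun v => dirDeriv_X v 1) hQ (Pi.single 0 1) (Pi.single 1 1)
    (by simp) (by simp) (by simp) (by simp) ?_ ?_ ?_
  · intro w h0 h1 h hf
    refine hext w h0 h1 ?_ fun i hi => ?_
    · rw [hB _ _ (by simp), sumMulFrom_single, if_neg hval1] at hf
      simpa [h21] using hf
    · have := h (Pi.single i 1) (by simp [hne0 i hi]) (by simp [hne1 i hi])
      simpa [hsingle w i hi] using this
  · intro z h0 h2 h
    have h1 : z 1 = 0 := by
      have := h (Pi.single 2 1) (by simp [h20.symm]) (by simp [h21.symm])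
      rw [hB _ _ (by simp [h20.symm]), hB _ _ (by simp [h20.symm]), sumMulFrom_single,
        sumMulFrom_single, if_neg hval2] at this
      simp [h21.symm] at this
      simpa [← two_mul] using this
    refine hext z h0 h1 h2 fun i hi => ?_
    have := h (Pi.single i 1) (by simp [hne0 i hi]) (by simp [hne1 i hi])
    simpa [hsingle _ i hi, h1] using this
  · intro v hv0 hv1 w h0 h1 h
    have h3 : ∀ i : Fin (k + 4), 3 ≤ (i : ℕ) → w i = 0 := fun i hi => by
      have := h (Pi.single i 1) (by simp [hne0 i hi]) (by simp [hne2 i hi])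
      rw [hQ.symm, hsingle w i hi] at this
      simpa [hne1 i hi] using this
    refine hext w h0 h1 ?_ h3
    have := h (Pi.single 1 1) (by simp) (by simp [h21])
    rw [hB _ _ h0, hB _ _ h0, sumMulFrom_eq_zero h3, sumMulFrom_eq_zero h3] at this
    simp only [LinearMap.proj_apply] at hv1 h1
    simp [h1, hv1, h21] at this
    simpa [← two_mul] using this

/-- For `n ≥ 3`, each of the quartics
`F₄, F₅, F₆, F₇, F_{8,λ}, F₉, F_{10,λ}` satisfies `rk(F) ≥ 4(n−1)` and
`prk(F) ≥ 3(n−1)`. -/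
theorem stmt14 (K : Type*) [Field K] [IsAlgClosed K] [CharZero K] (n : ℕ) (hn : 3 ≤ n)
    (F : MvPolynomial (Fin (n + 1)) K)
    (hF : F = X 0 * X 1 * sumSqFrom K (n + 1) 2 ∨
      F = X 0 * X 1 * (X 1 * X 2 + sumSqFrom K (n + 1) 3) ∨
      F = X 0 * X 1 * sumSqFrom K (n + 1) 1 ∨
      F = X 0 * (X 0 + X 1) * sumSqFrom K (n + 1) 1 ∨
      (∃ lam : K, F = X 0 * (C lam * X 0 + X 1) * sumSqFrom K (n + 1) 0) ∨
      F = X 0 * X 1 * ((X 0) ^ 2 + X 1 * X 2 + sumSqFrom K (n + 1) 3) ∨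
      (∃ lam : K, F = X 0 * (C (-lam ^ 2) * X 0 + X 1 + C lam * X 2) *
        (X 0 * X 1 + sumSqFrom K (n + 1) 2))) :
    4 * (n - 1) ≤ waringRank F 4 ∧ 3 * (n - 1) ≤ pWaringRank F 4 := by
  obtain ⟨k, rfl⟩ : ∃ k, n = k + 3 := ⟨n - 3, by omega⟩
  have hne0 : ∀ i : Fin (k + 4), 2 ≤ (i : ℕ) → (0 : Fin (k + 4)) ≠ i := by
    rintro i hi rfl; simp at hi
  have hne1 : ∀ i : Fin (k + 4), 2 ≤ (i : ℕ) → (1 : Fin (k + 4)) ≠ i := by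
    rintro i hi rfl; simp at hi
  have hext : ∀ w : Fin (k + 4) → K, w 0 = 0 → w 1 = 0 →
      (∀ i : Fin (k + 4), 2 ≤ (i : ℕ) → w i = 0) → w = 0 := by
    intro w h0 h1 h
    funext i
    rcases i with ⟨_ | _ | i, hi⟩
    · exact h0
    · exact h1
    · exact h _ (by simp)
  have hsum : ∀ (c : K) (t : ℕ), t ≤ 2 →
      4 * (k + 3 - 1) ≤ waringRank (X 0 * (C c * X 0 + X 1) * sumSqFrom K (k + 4) t) 4 ∧
      3 * (k + 3 - 1) ≤ pWaringRank (X 0 * (C c * X 0 + X 1) * sumSqFrom K (k + 4) t) 4 := by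
    intro c t ht
    refine le_waringRank_and_le_pWaringRank_of_nondegenerate
      (c • LinearMap.proj 0 + LinearMap.proj 1)
      (((isHomogeneous_X K _).C_mul c).add (isHomogeneous_X K _))
      (fun v => by simp [mul_comm]) (isQuadraticWithPolar_sumSqFrom K _ t) (by simp) ?_
    intro w h0 h1 h
    refine hext w h0 (by simpa [h0] using h1) fun i hi => ?_
    have := h (Pi.single i 1) (by simp [hne0 i hi]) (by simp [hne0 i hi, hne1 i hi])
    simpa [sumMulFrom_single, ht.trans hi] using this
  rcases hF with rfl | rfl | rfl | rfl | ⟨lam, rfl⟩ | rfl | ⟨lam, rfl⟩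
  · simpa using hsum 0 2 le_rfl
  · refine le_waringRank_and_le_pWaringRank_of_degenerate
      ((isQuadraticWithPolar_X_mul_X K _ _).add (isQuadraticWithPolar_sumSqFrom K _ _))
      fun u v hu => by ring
  · simpa using hsum 0 1 (by simp)
  · simpa using hsum 1 1 (by simp)
  · exact hsum lam 0 (by simp)
  · rw [pow_two]
    refine le_waringRank_and_le_pWaringRank_of_degenerate
      (((isQuadraticWithPolar_X_mul_X K _ _).add (isQuadraticWithPolar_X_mul_X K _ _)).add
        (isQuadraticWithPolar_sumSqFrom K _ _)) fun u v hu => by simp [hu]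
  · have hval : ((2 : Fin (k + 4)) : ℕ) = 2 := rfl
    have h20 := hne0 2 hval.ge
    have h21 := hne1 2 hval.ge
    refine le_waringRank_and_le_pWaringRank_of_nondegenerate
      (-lam ^ 2 • LinearMap.proj 0 + LinearMap.proj 1 + lam • LinearMap.proj 2)
      ((((isHomogeneous_X K _).C_mul _).add (isHomogeneous_X K _)).add
        ((isHomogeneous_X K _).C_mul _))
      (fun v => by simp)
      ((isQuadraticWithPolar_X_mul_X K _ _).add (isQuadraticWithPolar_sumSqFrom K _ _))
      (by simp [h21.symm]) ?_
    intro w h0 h1 h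
    have hw : ∀ i : Fin (k + 4), 2 ≤ (i : ℕ) → w i = 0 := fun i hi => by
      by_cases hi2 : i = 2
      · subst hi2
        have := h (Pi.single 2 1 - lam • Pi.single 1 1) (by simp [h20])
          (by simp [h20, h21, h21.symm])
        have hS : sumMulFrom 2 (Pi.single 2 1 - lam • Pi.single 1 1) w = 2 * w 2 := by
          rw [← if_pos (c := 2 ≤ ((2 : Fin (k + 4)) : ℕ)) (t := 2 * w 2) (e := 0) hi,
            ← sumMulFrom_single]
          refine Finset.sum_congr rfl fun j hj => ?_
          simp [(hne1 j (Finset.mem_filter.1 hj).2).symm]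
        rw [hS] at this
        simpa [h0, h20] using this
      · have := h (Pi.single i 1) (by simp [hne0 i hi])
          (by simp [hne0 i hi, hne1 i hi, Ne.symm hi2])
        simpa [sumMulFrom_single, hi, hne0 i hi, hne1 i hi] using this
    have h2 := hw 2 hval.ge
    exact hext w h0 (by simpa [h0, h2] using h1) hw
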